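/- Fix parameters α_0,…,α_5 with α_0+α_1+α_2+α_3+α_4+α_5 = 1 and fix i ∈ {0,…,5}. If (f_0,…,f_5) and (g_0,…,g_5) are both rational solutions of A_5(α_0,…,α_5) such that f_i, f_{i+1} (respectively g_i, g_{i+1}) have a pole at t=∞ and the remaining four components are holomorphic at t=∞, then f_j = g_j for all j = 0,…,5. -/

import Mathlib

open Filter Topology Polynomial

noncomputable section

/-- Evaluation of a complex rational function at a point (junk value where the
reduced denominator vanishes). -/
def evalR (f : RatFunc ℂ) (t : ℂ) : ℂ := RatFunc.eval (RingHom.id ℂ) t f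

/-- `f` is defined at `t`: the reduced denominator does not vanish at `t`. -/
def DefinedAt (f : RatFunc ℂ) (t : ℂ) : Prop := Polynomial.eval t (RatFunc.denom f) ≠ 0

/-- `(f 0, …, f 5)` is a rational solution of the `A₅⁽¹⁾` Painlevé system `A₅(α)`:
the two constraints hold identically as rational functions, and the six ODEs hold at
every point where all six components are defined.  (Indices are taken in `Fin 6`,
i.e. modulo `6`.) -/
def IsA5Solution (α : Fin 6 → ℂ) (f : Fin 6 → RatFunc ℂ) : Prop :=
  f 0 + f 2 + f 4 = RatFunc.X ∧
  f 1 + f 3 + f 5 = RatFunc.X ∧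
  ∀ t : ℂ, (∀ j : Fin 6, DefinedAt (f j) t) → ∀ i : Fin 6,
    t / 2 * deriv (evalR (f i)) t =
      evalR (f i) t *
        (evalR (f (i + 1)) t * evalR (f (i + 2)) t
          + evalR (f (i + 1)) t * evalR (f (i + 4)) t
          + evalR (f (i + 3)) t * evalR (f (i + 4)) t
          - evalR (f (i + 2)) t * evalR (f (i + 3)) t
          - evalR (f (i + 2)) t * evalR (f (i + 5)) t
          - evalR (f (i + 4)) t * evalR (f (i + 5)) t)
      + (1 / 2 - α (i + 2) - α (i + 4)) * evalR (f i) t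
      + α i * (evalR (f (i + 2)) t + evalR (f (i + 4)) t)

/-- `f` has a pole at `t = ∞`: `‖f t‖ → ∞` as `‖t‖ → ∞`. -/
def PoleAtInfty (f : RatFunc ℂ) : Prop :=
  Tendsto (fun t => ‖evalR f t‖) (Bornology.cobounded ℂ) atTop

/-- `f` is holomorphic at `t = ∞`: `f` is bounded as `‖t‖ → ∞`. -/
def HoloAtInfty (f : RatFunc ℂ) : Prop :=
  IsBoundedUnder (· ≤ ·) (Bornology.cobounded ℂ) fun t => ‖evalR f t‖

/-- `f` has a pole at `c ∈ ℂ`: `‖f t‖ → ∞` as `t → c`. -/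
def PoleAt (f : RatFunc ℂ) (c : ℂ) : Prop :=
  Tendsto (fun t => ‖evalR f t‖) (𝓝[≠] c) atTop

/-- `f` is regular at `c ∈ ℂ`: it extends continuously to `c`. -/
def RegularAt (f : RatFunc ℂ) (c : ℂ) : Prop :=
  ∃ L : ℂ, Tendsto (fun t => evalR f t) (𝓝[≠] c) (𝓝 L)

/-- `z` is an integer. -/
def IsInt (z : ℂ) : Prop := ∃ n : ℤ, z = (n : ℂ)

/-- `z` is an even integer. -/
def IsEvenInt (z : ℂ) : Prop := ∃ n : ℤ, z = 2 * (n : ℂ)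

/-- A tuple of rational functions has pole configuration of Type A at `t = ∞`. -/
def TypeA (f : Fin 6 → RatFunc ℂ) : Prop :=
  ∃ i : Fin 6,
    (PoleAtInfty (f i) ∧ PoleAtInfty (f (i + 1)) ∧ HoloAtInfty (f (i + 2)) ∧
      HoloAtInfty (f (i + 3)) ∧ HoloAtInfty (f (i + 4)) ∧ HoloAtInfty (f (i + 5))) ∨
    (PoleAtInfty (f i) ∧ PoleAtInfty (f (i + 3)) ∧ HoloAtInfty (f (i + 1)) ∧
      HoloAtInfty (f (i + 2)) ∧ HoloAtInfty (f (i + 4)) ∧ HoloAtInfty (f (i + 5))) ∨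
    (PoleAtInfty (f i) ∧ PoleAtInfty (f (i + 1)) ∧ PoleAtInfty (f (i + 2)) ∧
      PoleAtInfty (f (i + 4)) ∧ HoloAtInfty (f (i + 3)) ∧ HoloAtInfty (f (i + 5)))

/-- A tuple of rational functions has pole configuration of Type B at `t = ∞`. -/
def TypeB (f : Fin 6 → RatFunc ℂ) : Prop :=
  ∃ i : Fin 6,
    PoleAtInfty (f i) ∧ PoleAtInfty (f (i + 1)) ∧ PoleAtInfty (f (i + 2)) ∧
    PoleAtInfty (f (i + 3)) ∧ HoloAtInfty (f (i + 4)) ∧ HoloAtInfty (f (i + 5))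

open Asymptotics

theorem eventually_eval_ne_zero {p : ℂ[X]} (hp : p ≠ 0) :
    ∀ᶠ t in Bornology.cobounded ℂ, p.eval t ≠ 0 := by
  have h : Bornology.IsBounded (p.roots.toFinset : Set ℂ) := p.roots.toFinset.finite_toSet.isBounded
  filter_upwards [Bornology.isCobounded_def.1 h.compl] with t ht h0
  exact ht (by simp [hp, h0])

theorem eventually_definedAt (f : RatFunc ℂ) : ∀ᶠ t in Bornology.cobounded ℂ, DefinedAt f t :=
  eventually_eval_ne_zero f.denom_ne_zero

theorem isOpen_definedAt (f : RatFunc ℂ) : IsOpen {t | DefinedAt f t} :=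
  isOpen_ne_fun f.denom.continuous continuous_const

theorem evalR_eq_div (f : RatFunc ℂ) (t : ℂ) : evalR f t = f.num.eval t / f.denom.eval t := rfl

theorem evalR_add {f g : RatFunc ℂ} {t : ℂ} (hf : DefinedAt f t) (hg : DefinedAt g t) :
    evalR (f + g) t = evalR f t + evalR g t :=
  RatFunc.eval_add (RingHom.id ℂ) t hf hg

theorem hasDerivAt_evalR {f : RatFunc ℂ} {t : ℂ} (h : DefinedAt f t) :
    HasDerivAt (evalR f)
      ((f.num.derivative.eval t * f.denom.eval t - f.num.eval t * f.denom.derivative.eval t)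
        / f.denom.eval t ^ 2) t :=
  (f.num.hasDerivAt t).div (f.denom.hasDerivAt t) h

theorem eq_zero_of_eventually_evalR_eq_zero {f : RatFunc ℂ}
    (h : ∀ᶠ t in Bornology.cobounded ℂ, evalR f t = 0) : f = 0 := by
  by_contra hf
  obtain ⟨t, h0, hd, hn⟩ := (h.and ((eventually_definedAt f).and
    (eventually_eval_ne_zero (RatFunc.num_ne_zero hf)))).exists
  exact div_ne_zero hn hd h0

theorem isBigO_id_mul_derivative (p : ℂ[X]) :
    (fun t => t * p.derivative.eval t) =O[Bornology.cobounded ℂ] fun t => p.eval t := by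
  have h : (X * p.derivative).degree ≤ p.degree := by
    by_cases hp : p.derivative = 0
    · simp [hp]
    · rw [degree_mul, degree_X, add_comm]
      have hp0 : p ≠ 0 := by rintro rfl; simp at hp
      exact Nat.WithBot.add_one_le_of_lt (degree_derivative_lt hp0)
  simpa using isBigO_cobounded_of_degree_le h

/-- The logarithmic derivative of a rational function is `O(1 / t)` at infinity. -/
theorem isBigO_id_mul_deriv_evalR (f : RatFunc ℂ) :
    (fun t => t * deriv (evalR f) t) =O[Bornology.cobounded ℂ] evalR f := by
  have hn := (isBigO_id_mul_derivative f.num).mul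
    (isBigO_refl (fun t => (f.denom.eval t)⁻¹) (Bornology.cobounded ℂ))
  have hd := ((isBigO_id_mul_derivative f.denom).mul
    (isBigO_refl (fun t => (f.denom.eval t)⁻¹) (Bornology.cobounded ℂ))).mul
    (isBigO_refl (evalR f) (Bornology.cobounded ℂ))
  have hd' : (fun t => f.denom.eval t * (f.denom.eval t)⁻¹ * evalR f t)
      =ᶠ[Bornology.cobounded ℂ] evalR f := by
    filter_upwards [eventually_definedAt f] with t ht
    rw [mul_inv_cancel₀ ht, one_mul]
  refine (hn.sub (hd.trans_eventuallyEq hd')).congr' ?_ .rfl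
  filter_upwards [eventually_definedAt f] with t ht
  have ht' : f.denom.eval t ≠ 0 := ht
  rw [(hasDerivAt_evalR ht).deriv, evalR_eq_div]
  field_simp

theorem eventually_evalR_sub (f g : RatFunc ℂ) :
    ∀ᶠ t in Bornology.cobounded ℂ, evalR (f - g) t = evalR f t - evalR g t := by
  filter_upwards [eventually_definedAt (f - g), eventually_definedAt g] with t hd hg
  rw [eq_sub_iff_add_eq, ← evalR_add hd hg, sub_add_cancel]

theorem eventually_deriv_evalR_sub (f g : RatFunc ℂ) :
    ∀ᶠ t in Bornology.cobounded ℂ,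
      deriv (evalR (f - g)) t = deriv (evalR f) t - deriv (evalR g) t := by
  filter_upwards [eventually_definedAt (f - g), eventually_definedAt g] with t hd hg
  have h : evalR f =ᶠ[𝓝 t] evalR (f - g) + evalR g := by
    filter_upwards [(isOpen_definedAt _).mem_nhds hd, (isOpen_definedAt _).mem_nhds hg]
      with s hsd hsg
    rw [Pi.add_apply, ← evalR_add hsd hsg, sub_add_cancel]
  rw [h.deriv_eq, deriv_add (hasDerivAt_evalR hd).differentiableAt
    (hasDerivAt_evalR hg).differentiableAt, add_sub_cancel_right]

/-- `u` and `v` grow at most like `t ^ n` at infinity, and differ by `O(t ^ n * D t)`. -/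
structure CloseAtInfty (D : ℂ → ℝ) (n : ℕ) (u v : ℂ → ℂ) : Prop where
  left : u =O[Bornology.cobounded ℂ] fun t => ‖t‖ ^ n
  right : v =O[Bornology.cobounded ℂ] fun t => ‖t‖ ^ n
  sub : (fun t => u t - v t) =O[Bornology.cobounded ℂ] fun t => ‖t‖ ^ n * D t

namespace CloseAtInfty

variable {D : ℂ → ℝ} {m n : ℕ} {u v u' v' : ℂ → ℂ}

theorem refl (h : u =O[Bornology.cobounded ℂ] fun t => ‖t‖ ^ n) : CloseAtInfty D n u u :=
  ⟨h, h, by simpa using isBigO_zero _ _⟩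

theorem const (c : ℂ) : CloseAtInfty D 0 (fun _ => c) fun _ => c :=
  refl (by simpa using isBigO_const_const c (one_ne_zero (α := ℝ)) _)

theorem id : CloseAtInfty D 1 (fun t => t) fun t => t :=
  refl (by simpa using (isBigO_refl (fun t : ℂ => t) _).norm_right)

theorem add (h : CloseAtInfty D n u v) (h' : CloseAtInfty D n u' v') :
    CloseAtInfty D n (fun t => u t + u' t) fun t => v t + v' t :=
  ⟨h.left.add h'.left, h.right.add h'.right,
    (h.sub.add h'.sub).congr_left fun t => by ring⟩

theorem mul (h : CloseAtInfty D m u v) (h' : CloseAtInfty D n u' v') :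
    CloseAtInfty D (m + n) (fun t => u t * u' t) fun t => v t * v' t := by
  refine ⟨(h.left.mul h'.left).congr_right fun t => by ring,
    (h.right.mul h'.right).congr_right fun t => by ring, ?_⟩
  have h₁ := (h.sub.mul h'.left).congr_right
    (g₂ := fun t => ‖t‖ ^ (m + n) * D t) fun t => by ring
  have h₂ := (h.right.mul h'.sub).congr_right
    (g₂ := fun t => ‖t‖ ^ (m + n) * D t) fun t => by ring
  exact (h₁.add h₂).congr_left fun t => by ring

theorem neg (h : CloseAtInfty D n u v) : CloseAtInfty D n (fun t => -u t) fun t => -v t :=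
  ⟨h.left.neg_left, h.right.neg_left, h.sub.neg_left.congr_left fun t => by ring⟩

theorem sub' (h : CloseAtInfty D n u v) (h' : CloseAtInfty D n u' v') :
    CloseAtInfty D n (fun t => u t - u' t) fun t => v t - v' t := by
  simpa only [sub_eq_add_neg] using h.add h'.neg

theorem succ (h : CloseAtInfty D n u v) : CloseAtInfty D (n + 1) u v := by
  have hp : (fun t : ℂ => ‖t‖ ^ n) =O[Bornology.cobounded ℂ] fun t => ‖t‖ ^ (n + 1) := by
    refine .of_bound 1 ?_
    filter_upwards [eventually_cobounded_le_norm (1 : ℝ)] with t ht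
    simpa using pow_le_pow_right₀ ht n.le_succ
  exact ⟨h.left.trans hp, h.right.trans hp, h.sub.trans (hp.mul (isBigO_refl D _))⟩

theorem congr (h : CloseAtInfty D n u v) (hu : u =ᶠ[Bornology.cobounded ℂ] u')
    (hv : v =ᶠ[Bornology.cobounded ℂ] v') : CloseAtInfty D n u' v' :=
  ⟨h.left.congr' hu .rfl, h.right.congr' hv .rfl, h.sub.congr' (hu.sub hv) .rfl⟩

end CloseAtInfty

theorem IsA5Solution.shift {α : Fin 6 → ℂ} {f : Fin 6 → RatFunc ℂ} (h : IsA5Solution α f)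
    (i : Fin 6) : IsA5Solution (fun j => α (i + j)) fun j => f (i + j) := by
  obtain ⟨h0, h1, ho⟩ := h
  refine ⟨?_, ?_, fun t ht j => ?_⟩
  · fin_cases i <;> simp <;> first | linear_combination h0 | linear_combination h1
  · fin_cases i <;> simp <;> first | linear_combination h0 | linear_combination h1
  · have hd : ∀ j, DefinedAt (f j) t := fun j => by simpa using ht (j - i)
    simpa only [add_assoc] using ho t hd (i + j)

/-- If `p` and `q` satisfy the same equation, dominated at infinity by the term `s * t ^ 2 * p`, and
the remaining terms are close to first order, then `p - q = O(D / t)`. -/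
theorem isBigO_sq_mul_sub {D : ℂ → ℝ} {p q : RatFunc ℂ} {a a' b b' m m' : ℂ → ℂ} {s c : ℂ}
    (hs : s * s = 1) (hpq : CloseAtInfty D 0 (evalR p) (evalR q))
    (ha : CloseAtInfty D 1 a a') (hb : CloseAtInfty D 1 b b')
    (hm : CloseAtInfty D 1 (fun t => t ^ 2 - m t) fun t => t ^ 2 - m' t)
    (hp : ∀ᶠ t in Bornology.cobounded ℂ, t / 2 * deriv (evalR p) t =
      evalR p t * (a t + s * m t) + c * evalR p t + b t)
    (hq : ∀ᶠ t in Bornology.cobounded ℂ, t / 2 * deriv (evalR q) t =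
      evalR q t * (a' t + s * m' t) + c * evalR q t + b' t) :
    (fun t => ‖t‖ ^ 2 * ‖evalR (p - q) t‖) =O[Bornology.cobounded ℂ] fun t => ‖t‖ ^ 1 * D t := by
  have hrest := (((CloseAtInfty.const s).mul hm).mul hpq).sub'
    (((hpq.mul ha).add ((CloseAtInfty.const c).mul hpq).succ).add hb)
  have hsub : evalR (p - q) =O[Bornology.cobounded ℂ] fun t => ‖t‖ ^ 1 * D t :=
    hpq.succ.sub.congr' ((eventually_evalR_sub p q).mono fun t h => h.symm) .rfl
  have hder := (isBigO_id_mul_deriv_evalR (p - q)).trans hsub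
  refine ((hrest.sub.add (hder.const_mul_left (1 / 2))).const_mul_left s).norm_left.congr' ?_ .rfl
  filter_upwards [hp, hq, eventually_evalR_sub p q, eventually_deriv_evalR_sub p q]
    with t hp hq hd hd'
  rw [hd', hd, ← norm_pow, ← norm_mul]
  congr 1
  linear_combination s * hp - s * hq + t ^ 2 * (evalR p t - evalR q t) * hs

theorem eventually_eq_zero_of_sq_mul_isBigO {D : ℂ → ℝ}
    (h : (fun t => ‖t‖ ^ 2 * D t) =O[Bornology.cobounded ℂ] fun t => ‖t‖ ^ 1 * D t) :
    ∀ᶠ t in Bornology.cobounded ℂ, D t = 0 := by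
  obtain ⟨C, hC⟩ := h.bound
  filter_upwards [hC, eventually_cobounded_le_norm (max C 0 + 1)] with t ht hn
  by_contra h0
  have hD : 0 < ‖D t‖ := norm_pos_iff.2 h0
  have hC' : C < ‖t‖ := by linarith [le_max_left C 0]
  have ht0 : 0 < ‖t‖ := by linarith [le_max_right C 0]
  simp only [norm_mul, norm_pow, norm_norm, pow_one] at ht
  have := mul_pos (mul_pos (sub_pos.2 hC') ht0) hD
  linarith

theorem HoloAtInfty.isBigO {f : RatFunc ℂ} (h : HoloAtInfty f) :
    evalR f =O[Bornology.cobounded ℂ] fun t => ‖t‖ ^ 0 := by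
  simpa using h.isBigO_one ℝ

theorem IsA5Solution.eventually_evalR_zero_one {α : Fin 6 → ℂ} {f : Fin 6 → RatFunc ℂ}
    (h : IsA5Solution α f) : ∀ᶠ t in Bornology.cobounded ℂ,
      evalR (f 0) t = t - (evalR (f 2) t + evalR (f 4) t) ∧
      evalR (f 1) t = t - (evalR (f 3) t + evalR (f 5) t) := by
  have key : ∀ {x y z : RatFunc ℂ}, x + y + z = RatFunc.X → ∀ᶠ t in Bornology.cobounded ℂ,
      evalR x t = t - (evalR y t + evalR z t) := by
    intro x y z hx
    filter_upwards [eventually_definedAt x, eventually_definedAt y, eventually_definedAt z,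
      eventually_definedAt (x + y)] with t hx' hy' hz' hxy
    have := congrArg (evalR · t) hx
    simp only [evalR_add hxy hz', evalR_add hx' hy'] at this
    rw [show evalR RatFunc.X t = t by simp [evalR]] at this
    linear_combination this
  exact (key h.1).and (key h.2.1)

/-- A rational solution whose components `2, 3, 4, 5` are holomorphic at infinity is unique. -/
theorem IsA5Solution.eq_of_holoAtInfty {α : Fin 6 → ℂ} {f g : Fin 6 → RatFunc ℂ}
    (hf : IsA5Solution α f) (hg : IsA5Solution α g)
    (hfh : ∀ k ∈ ({2, 3, 4, 5} : Finset (Fin 6)), HoloAtInfty (f k))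
    (hgh : ∀ k ∈ ({2, 3, 4, 5} : Finset (Fin 6)), HoloAtInfty (g k)) : f = g := by
  let D : ℂ → ℝ := fun t => ∑ k ∈ ({2, 3, 4, 5} : Finset (Fin 6)), ‖evalR (f k - g k) t‖
  have hclose : ∀ k ∈ ({2, 3, 4, 5} : Finset (Fin 6)),
      CloseAtInfty D 0 (evalR (f k)) (evalR (g k)) := by
    refine fun k hk => ⟨(hfh k hk).isBigO, (hgh k hk).isBigO, .of_bound 1 ?_⟩
    filter_upwards [eventually_evalR_sub (f k) (g k)] with t ht
    rw [← ht, pow_zero, one_mul, one_mul]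
    exact (Finset.single_le_sum (f := fun k => ‖evalR (f k - g k) t‖)
      (fun _ _ => norm_nonneg _) hk).trans (le_abs_self _)
  have h2 := hclose 2 (by decide)
  have h3 := hclose 3 (by decide)
  have h4 := hclose 4 (by decide)
  have h5 := hclose 5 (by decide)
  have ef := hf.eventually_evalR_zero_one
  have eg := hg.eventually_evalR_zero_one
  have h0 : CloseAtInfty D 1 (evalR (f 0)) (evalR (g 0)) :=
    (CloseAtInfty.id.sub' (h2.add h4).succ).congr (ef.mono fun _ h => h.1.symm)
      (eg.mono fun _ h => h.1.symm)
  have h1 : CloseAtInfty D 1 (evalR (f 1)) (evalR (g 1)) :=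
    (CloseAtInfty.id.sub' (h3.add h5).succ).congr (ef.mono fun _ h => h.2.symm)
      (eg.mono fun _ h => h.2.symm)
  have hm : CloseAtInfty D 1 (fun t => t ^ 2 - evalR (f 0) t * evalR (f 1) t)
      fun t => t ^ 2 - evalR (g 0) t * evalR (g 1) t :=
    ((CloseAtInfty.id.mul (h3.add h5)).add ((h2.add h4).mul h1)).congr
      (ef.mono fun t h => by dsimp only; rw [h.1, h.2]; ring)
      (eg.mono fun t h => by dsimp only; rw [h.1, h.2]; ring)
  have hode : ∀ {F : Fin 6 → RatFunc ℂ}, IsA5Solution α F → ∀ᶠ t in Bornology.cobounded ℂ, _ :=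
    fun {F} hF => (eventually_all.2 fun j => eventually_definedAt (F j)).mono hF.2.2
  have b2 := isBigO_sq_mul_sub (s := -1) (c := 1 / 2 - α 4 - α 0) (by norm_num) h2
    (((((h3.mul h4).succ.add (h3.mul h0)).add (h5.mul h0)).sub' (h4.mul h5).succ).sub' (h4.mul h1))
    ((CloseAtInfty.const (α 2)).mul (h4.succ.add h0)) hm
    ((hode hf).mono fun t h => by
      have e := h 2
      simp only [Fin.reduceAdd] at e
      linear_combination e)
    ((hode hg).mono fun t h => by
      have e := h 2
      simp only [Fin.reduceAdd] at e
      linear_combination e)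
  have b3 := isBigO_sq_mul_sub (s := 1) (c := 1 / 2 - α 5 - α 1) (by norm_num) h3
    (((((h4.mul h5).succ.add (h4.mul h1)).sub' (h5.mul h0)).sub' (h5.mul h2).succ).sub' (h2.mul h1))
    ((CloseAtInfty.const (α 3)).mul (h5.succ.add h1)) hm
    ((hode hf).mono fun t h => by
      have e := h 3
      simp only [Fin.reduceAdd] at e
      linear_combination e)
    ((hode hg).mono fun t h => by
      have e := h 3
      simp only [Fin.reduceAdd] at e
      linear_combination e)
  have b4 := isBigO_sq_mul_sub (s := -1) (c := 1 / 2 - α 0 - α 2) (by norm_num) h4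
    (((((h5.mul h0).add (h5.mul h2).succ).add (h2.mul h1)).sub' (h3.mul h0)).sub' (h2.mul h3).succ)
    ((CloseAtInfty.const (α 4)).mul (h0.add h2.succ)) hm
    ((hode hf).mono fun t h => by
      have e := h 4
      simp only [Fin.reduceAdd] at e
      linear_combination e)
    ((hode hg).mono fun t h => by
      have e := h 4
      simp only [Fin.reduceAdd] at e
      linear_combination e)
  have b5 := isBigO_sq_mul_sub (s := 1) (c := 1 / 2 - α 1 - α 3) (by norm_num) h5
    (((((h3.mul h0).add (h2.mul h3).succ).sub' (h2.mul h1)).sub' (h4.mul h1)).sub' (h3.mul h4).succ)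
    ((CloseAtInfty.const (α 5)).mul (h1.add h3.succ)) hm
    ((hode hf).mono fun t h => by
      have e := h 5
      simp only [Fin.reduceAdd] at e
      linear_combination e)
    ((hode hg).mono fun t h => by
      have e := h 5
      simp only [Fin.reduceAdd] at e
      linear_combination e)
  have hzero := eventually_eq_zero_of_sq_mul_isBigO (D := D) <| by
    refine IsBigO.congr_left (((b2.add b3).add b4).add b5) fun t => ?_
    simp only [D]
    rw [Finset.sum_insert (by decide), Finset.sum_insert (by decide),
      Finset.sum_insert (by decide), Finset.sum_singleton]
    ring
  have heq : ∀ k ∈ ({2, 3, 4, 5} : Finset (Fin 6)), f k = g k := fun k hk =>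
    sub_eq_zero.1 <| eq_zero_of_eventually_evalR_eq_zero <| hzero.mono fun t ht =>
      norm_eq_zero.1 <| (Finset.sum_eq_zero_iff_of_nonneg fun _ _ => norm_nonneg _).1 ht k hk
  have e2 := heq 2 (by decide)
  have e3 := heq 3 (by decide)
  have e4 := heq 4 (by decide)
  have e5 := heq 5 (by decide)
  have e0 : f 0 = g 0 := by linear_combination hf.1 - hg.1 - e2 - e4
  have e1 : f 1 = g 1 := by linear_combination hf.2.1 - hg.2.1 - e3 - e5
  funext j
  fin_cases j
  exacts [e0, e1, e2, e3, e4, e5]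

/-- Uniqueness of a Type A (1) rational solution with a given pole configuration. -/
theorem stmt_2 (α : Fin 6 → ℂ) (i : Fin 6)
    (hsum : α 0 + α 1 + α 2 + α 3 + α 4 + α 5 = 1)
    (f g : Fin 6 → RatFunc ℂ)
    (hf : IsA5Solution α f) (hg : IsA5Solution α g)
    (hfpi : PoleAtInfty (f i)) (hfpi1 : PoleAtInfty (f (i + 1)))
    (hfh2 : HoloAtInfty (f (i + 2))) (hfh3 : HoloAtInfty (f (i + 3)))
    (hfh4 : HoloAtInfty (f (i + 4))) (hfh5 : HoloAtInfty (f (i + 5)))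
    (hgpi : PoleAtInfty (g i)) (hgpi1 : PoleAtInfty (g (i + 1)))
    (hgh2 : HoloAtInfty (g (i + 2))) (hgh3 : HoloAtInfty (g (i + 3)))
    (hgh4 : HoloAtInfty (g (i + 4))) (hgh5 : HoloAtInfty (g (i + 5))) :
    ∀ j : Fin 6, f j = g j := by
  have h : (fun j => f (i + j)) = fun j => g (i + j) := by
    refine (hf.shift i).eq_of_holoAtInfty (hg.shift i) ?_ ?_ <;> simp [*]
  intro j
  simpa using congrFun h (j - i)
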